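/- arXiv:1607.05830 — 2 statements merged into one kernel-verified Lean document; each statement's English description precedes it below -/
import Mathlib

section
/- Let f : Finset H → ℝ with f(∅) = 1. There exists a probability measure μ on (Set H, 𝔅) with μ(B_b) = f(b) for every finite b if and only if for every finite b ⊆ H and every a ⊆ b one has ∑_{c : a ⊆ c ⊆ b} (−1)^{|c \ a|} · f(c) ≥ 0. Moreover, when it exists, such a measure μ is unique. -/
open MeasureTheory Set

/-- A set of subsets of `H` is Scott-open if it is an upper set for inclusion and
meets every directed family of subsets whose union it contains. -/
def ScottOpen {H : Type*} (U : Set (Set H)) : Prop :=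
  (∀ ⦃a b : Set H⦄, a ⊆ b → a ∈ U → b ∈ U) ∧
  ∀ D : Set (Set H), D.Nonempty → DirectedOn (· ⊆ ·) D → ⋃₀ D ∈ U → (D ∩ U).Nonempty

/-- The Borel σ-algebra on `Set H` generated by the Scott-open sets. -/
def scottBorel (H : Type*) : MeasurableSpace (Set H) :=
  MeasurableSpace.generateFrom {U : Set (Set H) | ScottOpen U}

/-- `B_b = {c | b ⊆ c}`. -/
def Bset {H : Type*} (b : Set H) : Set (Set H) := {c | b ⊆ c}

theorem sum_interval_neg_one_pow_card_sdiff_left {H : Type*} [DecidableEq H] (a b : Finset H) :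
    ∑ c ∈ b.powerset.filter (fun c => a ⊆ c), (-1 : ℝ) ^ (c \ a).card =
      if a = b then 1 else 0 := by
  by_cases hab : a ⊆ b
  · have h : ∑ c ∈ b.powerset.filter (fun c => a ⊆ c), (-1 : ℝ) ^ (c \ a).card =
        ∑ d ∈ (b \ a).powerset, (-1 : ℝ) ^ d.card := by
      refine Finset.sum_nbij' (fun c => c \ a) (fun d => a ∪ d) ?_ ?_ ?_ ?_ ?_
      · intro c hc
        simp only [Finset.mem_filter, Finset.mem_powerset] at hc ⊢
        exact Finset.sdiff_subset_sdiff hc.1 subset_rfl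
      · intro d hd
        simp only [Finset.mem_filter, Finset.mem_powerset] at hd ⊢
        exact ⟨Finset.union_subset hab (hd.trans Finset.sdiff_subset), Finset.subset_union_left⟩
      · intro c hc
        simp only [Finset.mem_filter] at hc
        exact Finset.union_sdiff_of_subset hc.2
      · intro d hd
        rw [Finset.mem_powerset] at hd
        exact Finset.union_sdiff_cancel_left (Finset.disjoint_sdiff.mono_right hd)
      · intro c _
        rfl
    have hz := congrArg (Int.cast : ℤ → ℝ) (Finset.sum_powerset_neg_one_pow_card (x := b \ a))
    push_cast at hz
    rw [h, hz]
    refine if_congr ?_ rfl rfl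
    rw [Finset.sdiff_eq_empty_iff_subset]
    exact ⟨fun h => hab.antisymm h, fun h => h.ge⟩
  · rw [if_neg fun h => hab h.le]
    refine Finset.sum_eq_zero fun c hc => ?_
    simp only [Finset.mem_filter, Finset.mem_powerset] at hc
    exact absurd (hc.2.trans hc.1) hab

theorem sum_interval_neg_one_pow_card_sdiff_right {H : Type*} [DecidableEq H] (a b : Finset H) :
    ∑ c ∈ b.powerset.filter (fun c => a ⊆ c), (-1 : ℝ) ^ (b \ c).card =
      if a = b then 1 else 0 := by
  have h : ∀ c ∈ b.powerset.filter (fun c => a ⊆ c),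
      (-1 : ℝ) ^ (b \ c).card = (-1) ^ (b \ a).card * (-1) ^ (c \ a).card := by
    intro c hc
    simp only [Finset.mem_filter, Finset.mem_powerset] at hc
    have hcard : (b \ a).card = (b \ c).card + (c \ a).card := by
      have h1 := Finset.card_sdiff_add_card_eq_card hc.1
      have h2 := Finset.card_sdiff_add_card_eq_card hc.2
      have h3 := Finset.card_sdiff_add_card_eq_card (hc.2.trans hc.1)
      omega
    rw [hcard, pow_add, mul_assoc, ← mul_pow]
    simp
  rw [Finset.sum_congr rfl h, ← Finset.mul_sum, sum_interval_neg_one_pow_card_sdiff_left]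
  split_ifs with hab <;> simp [hab]

/-- The Möbius transform of `f` at `a` in the lattice of subsets of `b`. -/
noncomputable def mobiusWeight {H : Type*} [DecidableEq H] (f : Finset H → ℝ)
    (b a : Finset H) : ℝ :=
  ∑ c ∈ b.powerset.filter (fun c => a ⊆ c), (-1 : ℝ) ^ (c \ a).card * f c

theorem sum_mobiusWeight {H : Type*} [DecidableEq H] (f : Finset H → ℝ) {a b : Finset H}
    (hab : a ⊆ b) :
    ∑ c ∈ b.powerset.filter (fun c => a ⊆ c), mobiusWeight f b c = f a := by
  unfold mobiusWeight
  rw [Finset.sum_comm' (t' := b.powerset.filter (fun d => a ⊆ d))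
    (s' := fun d => d.powerset.filter (fun c => a ⊆ c))]
  · simp_rw [← Finset.sum_mul, sum_interval_neg_one_pow_card_sdiff_right, ite_mul, one_mul,
      zero_mul]
    rw [Finset.sum_ite_eq]
    simp [hab]
  · intro c d
    simp only [Finset.mem_filter, Finset.mem_powerset]
    constructor
    · rintro ⟨⟨_, hac⟩, hdb, hcd⟩
      exact ⟨⟨hcd, hac⟩, hdb, hac.trans hcd⟩
    · rintro ⟨⟨hcd, hac⟩, hdb, _⟩
      exact ⟨⟨hcd.trans hdb, hac⟩, hdb, hcd⟩

theorem scottOpen_Bset {H : Type*} (b : Finset H) : ScottOpen (Bset (b : Set H)) := by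
  refine ⟨fun _ _ h hb => Subset.trans hb h, fun D hD hdir hb => ?_⟩
  obtain ⟨d, hd, hbd⟩ := hdir.exists_mem_subset_of_finset_subset_biUnion (f := id) hD
    (by simpa [Bset, sUnion_eq_biUnion] using hb)
  exact ⟨d, hd, hbd⟩

theorem ScottOpen.exists_finset_subset {H : Type*} {U : Set (Set H)} (hU : ScottOpen U)
    {x : Set H} (hx : x ∈ U) : ∃ b : Finset H, (b : Set H) ⊆ x ∧ (b : Set H) ∈ U := by
  classical
  obtain ⟨_, ⟨b, hb, rfl⟩, hbU⟩ := hU.2 ((fun b : Finset H => (b : Set H)) '' {b | (b : Set H) ⊆ x})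
    ⟨_, ∅, by simp, rfl⟩ (by
      rintro _ ⟨b, hb, rfl⟩ _ ⟨c, hc, rfl⟩
      exact ⟨_, ⟨b ∪ c, by simpa using ⟨hb, hc⟩, rfl⟩, by simp, by simp⟩) (by
      convert hx
      ext h
      simp only [mem_sUnion, mem_image, mem_ofPred_eq, exists_exists_and_eq_and]
      exact ⟨fun ⟨b, hb, hh⟩ => hb hh, fun hh => ⟨{h}, by simpa using hh, by simp⟩⟩)
  exact ⟨b, hb, hbU⟩

theorem scottBorel_eq_generateFrom_Bset (H : Type*) [Countable H] :
    scottBorel H = MeasurableSpace.generateFrom (range fun b : Finset H => Bset (b : Set H)) := by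
  apply le_antisymm
  · refine MeasurableSpace.generateFrom_le fun U hU => ?_
    have h : U = ⋃ b : {b : Finset H // (b : Set H) ∈ U}, Bset ((b : Finset H) : Set H) := by
      ext x
      simp only [mem_iUnion]
      constructor
      · intro hx
        obtain ⟨b, hbx, hb⟩ := ScottOpen.exists_finset_subset hU hx
        exact ⟨⟨b, hb⟩, hbx⟩
      · rintro ⟨⟨b, hb⟩, hbx⟩
        exact hU.1 hbx hb
    rw [h]
    exact MeasurableSet.iUnion fun b =>
      MeasurableSpace.measurableSet_generateFrom (mem_range_self (b : Finset H))
  · refine MeasurableSpace.generateFrom_mono ?_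
    rintro _ ⟨b, rfl⟩
    exact scottOpen_Bset b

theorem isPiSystem_Bset (H : Type*) :
    IsPiSystem (range fun b : Finset H => Bset (b : Set H)) := by
  classical
  rintro _ ⟨b, rfl⟩ _ ⟨c, rfl⟩ _
  refine ⟨b ∪ c, ?_⟩
  ext x
  simp [Bset]

theorem measurableSet_Bset {H : Type*} (b : Finset H) :
    MeasurableSet[scottBorel H] (Bset (b : Set H)) :=
  MeasurableSpace.measurableSet_generateFrom (scottOpen_Bset b)

theorem measure_ext_Bset {H : Type*} [Countable H] {μ ν : @Measure (Set H) (scottBorel H)}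
    (hμ : @IsProbabilityMeasure (Set H) (scottBorel H) μ)
    (hν : @IsProbabilityMeasure (Set H) (scottBorel H) ν)
    (h : ∀ b : Finset H, μ (Bset (b : Set H)) = ν (Bset (b : Set H))) : μ = ν := by
  let _ := scottBorel H
  refine ext_of_generate_finite _ (scottBorel_eq_generateFrom_Bset H) (isPiSystem_Bset H) ?_ ?_
  · rintro _ ⟨b, rfl⟩
    exact h b
  · simp

theorem mobiusWeight_measure_nonneg {H : Type*} [DecidableEq H] [m : MeasurableSpace (Set H)]
    (μ : Measure (Set H)) [IsFiniteMeasure μ]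
    (hm : ∀ b : Finset H, MeasurableSet (Bset (b : Set H))) (b a : Finset H) :
    0 ≤ mobiusWeight (fun c => (μ (Bset (c : Set H))).toReal) b a := by
  classical
  have hint : ∀ c : Finset H,
      Integrable (fun x => (-1 : ℝ) ^ (c \ a).card * (Bset (c : Set H)).indicator 1 x) μ :=
    fun c => ((integrable_const (1 : ℝ)).indicator (hm c)).const_mul _
  have h : mobiusWeight (fun c => (μ (Bset (c : Set H))).toReal) b a =
      ∫ x, ∑ c ∈ b.powerset.filter (fun c => a ⊆ c),
        (-1 : ℝ) ^ (c \ a).card * (Bset (c : Set H)).indicator 1 x ∂μ := by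
    rw [integral_finsetSum _ fun c _ => hint c]
    refine Finset.sum_congr rfl fun c _ => ?_
    rw [integral_const_mul, integral_indicator_one (hm c), Measure.real]
  rw [h]
  refine integral_nonneg fun x => ?_
  have hx : ∑ c ∈ b.powerset.filter (fun c => a ⊆ c),
        (-1 : ℝ) ^ (c \ a).card * (Bset (c : Set H)).indicator 1 x =
      ∑ c ∈ (b.filter (· ∈ x)).powerset.filter (fun c => a ⊆ c), (-1 : ℝ) ^ (c \ a).card := by
    simp only [indicator_apply, Pi.one_apply, mul_ite, mul_one, mul_zero]
    rw [← Finset.sum_filter]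
    refine Finset.sum_congr ?_ fun _ _ => rfl
    ext c
    simp only [Finset.mem_filter, Finset.mem_powerset, Bset, mem_ofPred_eq, Finset.subset_iff,
      Set.subset_def, Finset.mem_coe]
    grind
  simp only [Pi.zero_apply, hx, sum_interval_neg_one_pow_card_sdiff_left]
  split_ifs <;> norm_num

/-- The cylinder of Boolean functions that are `true` on `b`, which corresponds to `Bset b`
when subsets of `H` are represented by Boolean functions. -/
def trueCylinder {H : Type*} (b : Finset H) : Set (H → Bool) := {x | ∀ h ∈ b, x h = true}

theorem isClopen_trueCylinder {H : Type*} (b : Finset H) : IsClopen (trueCylinder b) := by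
  have h : trueCylinder b = ⋂ h ∈ b, (fun x : H → Bool => x h) ⁻¹' {true} := by
    ext x
    simp [trueCylinder]
  rw [h]
  exact isClopen_biInter_finset fun h _ => (isClopen_discrete _).preimage (continuous_apply h)

/-- The discrete measure giving mass `mobiusWeight f S a` to (the indicator of) each `a ⊆ S`. -/
noncomputable def mobiusMeasure {H : Type*} [DecidableEq H] (f : Finset H → ℝ) (S : Finset H) :
    Measure (H → Bool) :=
  ∑ a ∈ S.powerset, ENNReal.ofReal (mobiusWeight f S a) • Measure.dirac (fun h => decide (h ∈ a))

theorem mobiusMeasure_trueCylinder {H : Type*} [Countable H] [DecidableEq H] {f : Finset H → ℝ}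
    (hpos : ∀ b a : Finset H, a ⊆ b → 0 ≤ mobiusWeight f b a) {b S : Finset H} (hb : b ⊆ S) :
    mobiusMeasure f S (trueCylinder b) = ENNReal.ofReal (f b) := by
  classical
  rw [← sum_mobiusWeight f hb, ENNReal.ofReal_sum_of_nonneg, mobiusMeasure,
    Measure.coe_finsetSum, Finset.sum_apply, Finset.sum_filter]
  · refine Finset.sum_congr rfl fun a _ => ?_
    rw [Measure.smul_apply, Measure.dirac_apply' _ (isClopen_trueCylinder b).isOpen.measurableSet,
      indicator_apply]
    simp [trueCylinder, Finset.subset_iff]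
  · intro c hc
    simp only [Finset.mem_filter, Finset.mem_powerset] at hc
    exact hpos _ _ hc.1

theorem exists_measure_trueCylinder {H : Type*} [Countable H] [DecidableEq H] {f : Finset H → ℝ}
    (hf : f ∅ = 1) (hpos : ∀ b a : Finset H, a ⊆ b → 0 ≤ mobiusWeight f b a) :
    ∃ μ : ProbabilityMeasure (H → Bool),
      ∀ b, (μ : Measure (H → Bool)) (trueCylinder b) = ENNReal.ofReal (f b) := by
  have hprob : ∀ S, IsProbabilityMeasure (mobiusMeasure f S) := fun S => ⟨by
    have h := mobiusMeasure_trueCylinder hpos (Finset.empty_subset S)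
    simpa [trueCylinder, hf] using h⟩
  let P : Finset H → ProbabilityMeasure (H → Bool) := fun S => ⟨mobiusMeasure f S, hprob S⟩
  let 𝒰 : Ultrafilter (Finset H) := Ultrafilter.of Filter.atTop
  obtain ⟨μ, -, hμ⟩ := isCompact_univ.ultrafilter_le_nhds (𝒰.map P) (by simp)
  refine ⟨μ, fun b => ?_⟩
  have hP : Filter.Tendsto P (𝒰 : Filter (Finset H)) (nhds μ) := hμ
  have hlim := ProbabilityMeasure.tendsto_measure_of_null_frontier_of_tendsto' hP
    (E := trueCylinder b) (by simp [(isClopen_trueCylinder b).frontier_eq])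
  refine tendsto_nhds_unique hlim (tendsto_const_nhds.congr' ?_)
  have hev : ∀ᶠ S in (𝒰 : Filter (Finset H)), b ⊆ S :=
    (Ultrafilter.of_le Filter.atTop) (Filter.eventually_ge_atTop b)
  filter_upwards [hev] with S hS
  exact (mobiusMeasure_trueCylinder hpos hS).symm

theorem exists_measure_Bset {H : Type*} [Countable H] [DecidableEq H] {f : Finset H → ℝ}
    (hf : f ∅ = 1) (hpos : ∀ b a : Finset H, a ⊆ b → 0 ≤ mobiusWeight f b a) :
    ∃ μ : @Measure (Set H) (scottBorel H), @IsProbabilityMeasure (Set H) (scottBorel H) μ ∧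
      ∀ b : Finset H, (μ (Bset (b : Set H))).toReal = f b := by
  let _ := scottBorel H
  obtain ⟨μ, hμ⟩ := exists_measure_trueCylinder hf hpos
  have hpre : ∀ b : Finset H,
      (fun x : H → Bool => {h | x h = true}) ⁻¹' Bset (b : Set H) = trueCylinder b :=
    fun b => rfl
  have hmeas : Measurable (fun x : H → Bool => {h | x h = true}) := by
    refine measurable_generateFrom (s := range fun b : Finset H => Bset (b : Set H)) ?_ |>.mono
      le_rfl (scottBorel_eq_generateFrom_Bset H).le
    rintro _ ⟨b, rfl⟩
    exact (isClopen_trueCylinder b).isOpen.measurableSet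
  refine ⟨(μ : Measure (H → Bool)).map _, Measure.isProbabilityMeasure_map hmeas.aemeasurable,
    fun b => ?_⟩
  rw [Measure.map_apply hmeas (measurableSet_Bset b), hpre, hμ, ENNReal.toReal_ofReal]
  rw [← sum_mobiusWeight f (Finset.Subset.refl b)]
  exact Finset.sum_nonneg fun c hc =>
    hpos b c (Finset.mem_powerset.1 (Finset.mem_filter.1 hc).1)

/-- Extension theorem: a function `f` on finite sets with `f ∅ = 1` arises as
`b ↦ μ (B_b)` for a (necessarily unique) probability measure `μ` on `(Set H, 𝔅)`
iff all the alternating inclusion-exclusion sums are nonnegative. -/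
theorem extension_theorem {H : Type*} [Countable H] [DecidableEq H]
    (f : Finset H → ℝ) (hf : f ∅ = 1) :
    ((∃ μ : @Measure (Set H) (scottBorel H),
        @IsProbabilityMeasure (Set H) (scottBorel H) μ ∧
        ∀ b : Finset H, (μ (Bset (↑b))).toReal = f b) ↔
      ∀ b a : Finset H, a ⊆ b →
        0 ≤ ∑ c ∈ b.powerset.filter (fun c => a ⊆ c), (-1 : ℝ) ^ (c \ a).card * f c) ∧
    (∀ μ ν : @Measure (Set H) (scottBorel H),
      @IsProbabilityMeasure (Set H) (scottBorel H) μ →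
      @IsProbabilityMeasure (Set H) (scottBorel H) ν →
      (∀ b : Finset H, (μ (Bset (↑b))).toReal = f b) →
      (∀ b : Finset H, (ν (Bset (↑b))).toReal = f b) → μ = ν) := by
  refine ⟨⟨?_, exists_measure_Bset hf⟩, ?_⟩
  · rintro ⟨μ, hμ, h⟩ b a _
    let _ := scottBorel H
    simpa only [mobiusWeight, h] using mobiusWeight_measure_nonneg μ measurableSet_Bset b a
  · intro μ ν hμ hν hμf hνf
    refine measure_ext_Bset hμ hν fun b => ?_
    rw [← ENNReal.toReal_eq_toReal_iff' (@measure_ne_top _ (_) _ _ _)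
      (@measure_ne_top _ (_) _ _ _), hμf, hνf]
end

section
/- Let f : Set H → ℝ≥0∞ be Scott-continuous and bounded (there is M < ∞ with f(a) ≤ M for all a), and let μ be a probability measure on (Set H, 𝔅). Then the integral of f is approximated both from below and from above by integrals of 𝒪-simple functions: ⨆ { ∫⁻ g dμ : g 𝒪-simple, g ≤ f } = ∫⁻ f dμ = ⨅ { ∫⁻ g dμ : g 𝒪-simple, f ≤ g }, where a function g : Set H → ℝ≥0∞ is 𝒪-simple if it is a finite sum g = ∑_{i=1}^k r_i · 1_{A_i} with each A_i Scott-open and each r_i ∈ ℝ≥0∞. -/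
open MeasureTheory Set ENNReal

/-- A function `f : Set H → ℝ≥0∞` is Scott-continuous if it is monotone with respect
to `⊆` and preserves suprema of nonempty directed families. -/
def ScottCont {H : Type*} (f : Set H → ℝ≥0∞) : Prop :=
  Monotone f ∧
  ∀ D : Set (Set H), D.Nonempty → DirectedOn (· ⊆ ·) D → f (⋃₀ D) = ⨆ a ∈ D, f a

/-- A function is `𝒪`-simple if it is a finite linear combination of indicator
functions of Scott-open sets. -/
def OSimple {H : Type*} (g : Set H → ℝ≥0∞) : Prop :=
  ∃ (k : ℕ) (r : Fin k → ℝ≥0∞) (A : Fin k → Set (Set H)),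
    (∀ i, ScottOpen (A i)) ∧ g = fun c => ∑ i, (A i).indicator (fun _ => r i) c

/-- The staircase with `n` steps of height `ε` approximating the identity from below. -/
noncomputable def staircase (ε : ℝ≥0∞) (n : ℕ) (x : ℝ≥0∞) : ℝ≥0∞ :=
  ∑ i : Fin n, (Ioi (((i : ℕ) + 1 : ℝ≥0∞) * ε)).indicator (fun _ => ε) x

lemma staircase_succ (ε : ℝ≥0∞) (n : ℕ) (x : ℝ≥0∞) :
    staircase ε (n + 1) x =
      staircase ε n x + (Ioi ((n + 1 : ℝ≥0∞) * ε)).indicator (fun _ => ε) x := by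
  simp [staircase, Fin.sum_univ_castSucc]

lemma staircase_le_min (ε x : ℝ≥0∞) (n : ℕ) : staircase ε n x ≤ min x (n * ε) := by
  induction n with
  | zero => simp [staircase]
  | succ n ih =>
    rw [staircase_succ]
    obtain ⟨hx, hn⟩ := le_min_iff.1 ih
    have hmul : ((n + 1 : ℕ) : ℝ≥0∞) * ε = n * ε + ε := by push_cast; ring
    by_cases h : (n + 1 : ℝ≥0∞) * ε < x
    · rw [indicator_of_mem (show x ∈ Ioi _ from h)]
      have hle : staircase ε n x + ε ≤ ((n + 1 : ℕ) : ℝ≥0∞) * ε := by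
        rw [hmul]; gcongr
      refine le_min (hle.trans ?_) hle
      push_cast
      exact h.le
    · rw [indicator_of_notMem (show x ∉ Ioi _ from h), add_zero, hmul]
      exact le_min hx (hn.trans le_self_add)

lemma min_le_staircase_add (ε x : ℝ≥0∞) (n : ℕ) :
    min x ((n + 1) * ε) ≤ staircase ε n x + ε := by
  induction n with
  | zero => simp [staircase]
  | succ n ih =>
    rw [staircase_succ]
    by_cases h : (n + 1 : ℝ≥0∞) * ε < x
    · rw [indicator_of_mem (show x ∈ Ioi _ from h)]
      rw [min_eq_right h.le] at ih
      refine (min_le_right _ _).trans ?_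
      calc (((n + 1 : ℕ) : ℝ≥0∞) + 1) * ε = (n + 1) * ε + ε := by push_cast; ring
        _ ≤ _ := by gcongr
    · rw [indicator_of_notMem (show x ∉ Ioi _ from h), add_zero]
      rw [min_eq_left (not_lt.1 h)] at ih
      exact (min_le_left _ _).trans ih

lemma ScottCont.scottOpen_lt {H : Type*} {f : Set H → ℝ≥0∞} (hf : ScottCont f) (t : ℝ≥0∞) :
    ScottOpen {c | t < f c} := by
  refine ⟨fun a b hab ha => lt_of_lt_of_le ha (hf.1 hab), fun D hne hD h => ?_⟩
  rw [mem_ofPred_eq, hf.2 D hne hD] at h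
  simp only [lt_iSup_iff] at h
  obtain ⟨a, ha, hlt⟩ := h
  exact ⟨a, ha, hlt⟩

lemma scottOpen_univ {H : Type*} : ScottOpen (univ : Set (Set H)) :=
  ⟨fun _ _ _ _ => mem_univ _, fun _ hne _ _ => by simpa using hne⟩

lemma ScottCont.oSimple_staircase {H : Type*} {f : Set H → ℝ≥0∞} (hf : ScottCont f)
    (ε : ℝ≥0∞) (n : ℕ) : OSimple fun c => staircase ε n (f c) :=
  ⟨n, fun _ => ε, fun i => {c | ((i : ℕ) + 1 : ℝ≥0∞) * ε < f c},
    fun _ => hf.scottOpen_lt _, rfl⟩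

lemma OSimple.add_const {H : Type*} {g : Set H → ℝ≥0∞} (hg : OSimple g) (ε : ℝ≥0∞) :
    OSimple fun c => g c + ε := by
  obtain ⟨k, r, A, hA, rfl⟩ := hg
  refine ⟨k + 1, Fin.snoc r ε, Fin.snoc (α := fun _ => Set (Set H)) A univ, fun i => ?_, ?_⟩
  · refine Fin.lastCases ?_ (fun j => ?_) i
    · simpa using scottOpen_univ
    · simpa using hA j
  · funext c
    simp [Fin.sum_univ_castSucc]

/-- A bounded Scott-continuous function is uniformly approximated from below by
`𝒪`-simple functions. -/
lemma ScottCont.exists_oSimple_le_le_add {H : Type*} {f : Set H → ℝ≥0∞} (hf : ScottCont f)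
    {M : ℝ≥0∞} (hM : M < ⊤) (hfM : ∀ a, f a ≤ M) {ε : ℝ≥0∞} (hε : ε ≠ 0) :
    ∃ g, OSimple g ∧ g ≤ f ∧ f ≤ fun c => g c + ε := by
  obtain ⟨n, hn⟩ := ENNReal.exists_nat_mul_gt hε hM.ne
  refine ⟨_, hf.oSimple_staircase ε n, fun c => (staircase_le_min ε (f c) n).trans
    (min_le_left _ _), fun c => le_trans (le_min le_rfl ?_) (min_le_staircase_add ε (f c) n)⟩
  calc f c ≤ n * ε := (hfM c).trans hn.le
    _ ≤ (n + 1) * ε := by gcongr; exact le_self_add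

/-- The integral of a bounded Scott-continuous function is approximated both from below
and from above by integrals of `𝒪`-simple functions. -/
theorem lintegral_bounded_approx {H : Type*} [Countable H]
    (f : Set H → ℝ≥0∞) (hf : ScottCont f)
    (hbdd : ∃ M : ℝ≥0∞, M < ⊤ ∧ ∀ a : Set H, f a ≤ M)
    (μ : @Measure (Set H) (scottBorel H))
    (hμ : @IsProbabilityMeasure (Set H) (scottBorel H) μ) :
    (⨆ (g : Set H → ℝ≥0∞) (_ : OSimple g) (_ : g ≤ f), MeasureTheory.lintegral μ g) =
        MeasureTheory.lintegral μ f ∧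
      MeasureTheory.lintegral μ f =
        ⨅ (g : Set H → ℝ≥0∞) (_ : OSimple g) (_ : f ≤ g), MeasureTheory.lintegral μ g := by
  obtain ⟨M, hM, hfM⟩ := hbdd
  let _ := scottBorel H
  have key : ∀ ε : ℝ≥0∞, ε ≠ 0 → ∃ g, OSimple g ∧ g ≤ f ∧ (f ≤ fun c => g c + ε) ∧
      ∫⁻ c, (g c + ε) ∂μ = ∫⁻ c, g c ∂μ + ε := fun ε hε => by
    obtain ⟨g, hg, hgf, hfg⟩ := hf.exists_oSimple_le_le_add hM hfM hε
    refine ⟨g, hg, hgf, hfg, ?_⟩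
    rw [lintegral_add_right _ measurable_const, lintegral_const, measure_univ, mul_one]
  refine ⟨le_antisymm (iSup_le fun g => iSup₂_le fun _ hgf => lintegral_mono hgf) ?_,
    le_antisymm (le_iInf fun g => le_iInf₂ fun _ hfg => lintegral_mono hfg) ?_⟩
  · refine ENNReal.le_of_forall_pos_le_add fun ε hε _ => ?_
    obtain ⟨g, hg, hgf, hfg, hint⟩ := key ε (by simpa using hε.ne')
    calc ∫⁻ c, f c ∂μ ≤ ∫⁻ c, (g c + ε) ∂μ := lintegral_mono hfg
      _ = ∫⁻ c, g c ∂μ + ε := hint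
      _ ≤ _ := by
        gcongr
        exact le_iSup_of_le g (le_iSup₂_of_le hg hgf le_rfl)
  · refine ENNReal.le_of_forall_pos_le_add fun ε hε _ => ?_
    obtain ⟨g, hg, hgf, hfg, hint⟩ := key ε (by simpa using hε.ne')
    refine iInf_le_of_le (fun c => g c + (ε : ℝ≥0∞))
      (iInf₂_le_of_le (hg.add_const ε) hfg ?_)
    rw [hint]
    gcongr
    exact hgf _
end
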